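/- Let R be a commutative ring. The following are equivalent: (1) R is w-semi-hereditary, i.e., every finite type ideal of R is w-projective; (2) every finite type submodule of a free R-module is weak w-projective; (3) every finite type ideal of R is weak w-projective; (4) every finitely generated submodule of a free R-module is weak w-projective; (5) every finitely generated ideal of R is weak w-projective. -/

import Mathlib

/-!  Background definitions for the `w`-operation theory of Wang–Kim–Qiao.  -/

open CategoryTheory

section WTheory

variable (R : Type) [CommRing R]

/-- `J` is a Glaz–Vasconcelos ideal: it is finitely generated and the natural map
`R → Hom_R(J, R)`, sending `r` to multiplication by `r`, is bijective. -/
def IsGVIdeal (J : Ideal R) : Prop :=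
  J.FG ∧ Function.Bijective fun r : R => (r • J.subtype : J →ₗ[R] R)

/-- `M` is `GV`-torsion: every element is annihilated by some GV-ideal. -/
def IsGVTorsion (M : Type*) [AddCommGroup M] [Module R M] : Prop :=
  ∀ x : M, ∃ J : Ideal R, IsGVIdeal R J ∧ ∀ j ∈ J, j • x = 0

/-- `M` is `GV`-torsion-free: no nonzero element is annihilated by a GV-ideal. -/
def IsGVTorsionFree (M : Type*) [AddCommGroup M] [Module R M] : Prop :=
  ∀ x : M, (∃ J : Ideal R, IsGVIdeal R J ∧ ∀ j ∈ J, j • x = 0) → x = 0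

/-- `Ext^n_R(M, N)`, as an `R`-module. -/
noncomputable def extM (M N : Type) [AddCommGroup M] [Module R M]
    [AddCommGroup N] [Module R N] (n : ℕ) : ModuleCat R :=
  ((Ext R (ModuleCat R) n).obj (Opposite.op (ModuleCat.of R M))).obj (ModuleCat.of R N)

/-- `M` is a `w`-module: it is GV-torsion-free and `Ext^1_R(R/J, M) = 0`
for every GV-ideal `J`. -/
def IsWModule (M : Type) [AddCommGroup M] [Module R M] : Prop :=
  IsGVTorsionFree R M ∧
    ∀ J : Ideal R, IsGVIdeal R J → Subsingleton (extM R (R ⧸ J) M 1)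

/-- `(L, ι)` is a `w`-envelope of `M`: `L` is a `w`-module, `ι : M → L` is an injective
linear map, and its cokernel is GV-torsion. -/
def IsWEnvelope (M L : Type) [AddCommGroup M] [Module R M] [AddCommGroup L]
    [Module R L] (ι : M →ₗ[R] L) : Prop :=
  IsWModule R L ∧ Function.Injective ι ∧ IsGVTorsion R (L ⧸ LinearMap.range ι)

/-- The GV-torsion submodule `tor_GV(M)`.  (The displayed generating set is already closed
under the module operations, since the GV-ideals form a multiplicative system of ideals,
so the span coincides with the displayed set.) -/
def torGV (M : Type) [AddCommGroup M] [Module R M] : Submodule R M :=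
  Submodule.span R {x : M | ∃ J : Ideal R, IsGVIdeal R J ∧ ∀ j ∈ J, j • x = 0}

/-- `M` is `w`-projective: for every GV-torsion-free `w`-module `N` and every
`w`-envelope `(L, ι)` of `M / tor_GV(M)`, the module `Ext^1_R(L, N)` is GV-torsion. -/
def IsWProjective (M : Type) [AddCommGroup M] [Module R M] : Prop :=
  ∀ (N : Type) [AddCommGroup N] [Module R N], IsGVTorsionFree R N → IsWModule R N →
    ∀ (L : Type) [AddCommGroup L] [Module R L] (ι : (M ⧸ torGV R M) →ₗ[R] L),
      IsWEnvelope R (M ⧸ torGV R M) L ι → IsGVTorsion R (extM R L N 1)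

/-- `N` belongs to the class `P_w^{†∞}`: it is GV-torsion-free and
`Ext^k_R(M, N) = 0` for every `w`-projective `M` and every `k ≥ 1`. -/
def MemPwDaggerInfty (N : Type) [AddCommGroup N] [Module R N] : Prop :=
  IsGVTorsionFree R N ∧
    ∀ (M : Type) [AddCommGroup M] [Module R M], IsWProjective R M →
      ∀ k : ℕ, 1 ≤ k → Subsingleton (extM R M N k)

/-- `M` is weak `w`-projective: `Ext^1_R(M, N) = 0` for every `N ∈ P_w^{†∞}`. -/
def IsWeakWProjective (M : Type) [AddCommGroup M] [Module R M] : Prop :=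
  ∀ (N : Type) [AddCommGroup N] [Module R N], MemPwDaggerInfty R N →
    Subsingleton (extM R M N 1)

end WTheory

section WExactness

variable (R : Type) [CommRing R]

/-- `I` is a `w`-ideal of `R`. -/
def IsWIdeal (I : Ideal R) : Prop :=
  ∀ x : R, (∃ J : Ideal R, IsGVIdeal R J ∧ ∀ j ∈ J, j * x ∈ I) → x ∈ I

/-- `P` is a maximal `w`-ideal: it is maximal among proper `w`-ideals of `R`.
(Every maximal `w`-ideal is a prime ideal.) -/
def IsMaxWIdeal (P : Ideal R) : Prop :=
  IsWIdeal R P ∧ P ≠ ⊤ ∧ ∀ I : Ideal R, IsWIdeal R I → I ≠ ⊤ → P ≤ I → I = P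

/-- The localization of a linear map at a submonoid. -/
noncomputable def locMap (S : Submonoid R) {A B : Type} [AddCommGroup A] [Module R A]
    [AddCommGroup B] [Module R B] (f : A →ₗ[R] B) :
    LocalizedModule S A →ₗ[R] LocalizedModule S B :=
  IsLocalizedModule.map S (LocalizedModule.mkLinearMap S A) (LocalizedModule.mkLinearMap S B) f

/-- `f` is a `w`-monomorphism: its localization at every maximal `w`-ideal is injective. -/
def IsWMono {A B : Type} [AddCommGroup A] [Module R A] [AddCommGroup B] [Module R B]
    (f : A →ₗ[R] B) : Prop :=
  ∀ (P : Ideal R), IsMaxWIdeal R P → ∀ [P.IsPrime],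
    Function.Injective (locMap R P.primeCompl f)

/-- `f` is a `w`-epimorphism: its localization at every maximal `w`-ideal is surjective. -/
def IsWEpi {A B : Type} [AddCommGroup A] [Module R A] [AddCommGroup B] [Module R B]
    (f : A →ₗ[R] B) : Prop :=
  ∀ (P : Ideal R), IsMaxWIdeal R P → ∀ [P.IsPrime],
    Function.Surjective (locMap R P.primeCompl f)

/-- `0 → A → B → C → 0` is a `w`-exact sequence: its localization at every maximal
`w`-ideal is a short exact sequence. -/
def IsWShortExact {A B C : Type} [AddCommGroup A] [Module R A] [AddCommGroup B] [Module R B]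
    [AddCommGroup C] [Module R C] (f : A →ₗ[R] B) (g : B →ₗ[R] C) : Prop :=
  ∀ (P : Ideal R), IsMaxWIdeal R P → ∀ [P.IsPrime],
    Function.Injective (locMap R P.primeCompl f) ∧
    Function.Exact (locMap R P.primeCompl f) (locMap R P.primeCompl g) ∧
    Function.Surjective (locMap R P.primeCompl g)

/-- `M` is of finite type: there is a `w`-epimorphism from a finitely generated free module. -/
def IsFiniteType (M : Type) [AddCommGroup M] [Module R M] : Prop :=
  ∃ (n : ℕ) (g : (Fin n → R) →ₗ[R] M), IsWEpi R g

/-- `M` is of finitely presented type: there is a `w`-exact sequence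
`F₁ → F₀ → M → 0` with `F₁`, `F₀` finitely generated free. -/
def IsFinitelyPresentedType (M : Type) [AddCommGroup M] [Module R M] : Prop :=
  ∃ (m n : ℕ) (f : (Fin m → R) →ₗ[R] (Fin n → R)) (g : (Fin n → R) →ₗ[R] M),
    IsWEpi R g ∧ ∀ (P : Ideal R), IsMaxWIdeal R P → ∀ [P.IsPrime],
      Function.Exact (locMap R P.primeCompl f) (locMap R P.primeCompl g)

/-- `M` is `w`-flat: tensoring with `M` preserves `w`-monomorphisms. -/
def IsWFlat (M : Type) [AddCommGroup M] [Module R M] : Prop :=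
  ∀ (A B : Type) [AddCommGroup A] [Module R A] [AddCommGroup B] [Module R B]
    (f : A →ₗ[R] B), IsWMono R f → IsWMono R (LinearMap.lTensor M f)

end WExactness

section ExtBridge

variable {R : Type} [CommRing R]

/-- A presentation of `Ext^(n+1)` by cocycles of a projective resolution. -/
theorem exists_cocycle_map {M : Type} [AddCommGroup M] [Module R M] (N : Type) [AddCommGroup N]
    [Module R N] (P : ProjectiveResolution (ModuleCat.of R M)) (n : ℕ) :
    ∃ φ : {c : P.complex.X (n + 1) ⟶ ModuleCat.of R N //
        P.complex.d (n + 2) (n + 1) ≫ c = 0} → extM R M N (n + 1),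
      Function.Surjective φ ∧
      (∀ (r : R) c c', c'.1 = r • c.1 → φ c' = r • φ c) ∧
      ∀ c, φ c = 0 ↔ ∃ b, c.1 = P.complex.d (n + 1) n ≫ b := by
  let K := P.complex.linearYonedaObj R (ModuleCat.of R N)
  let S := K.sc' n (n + 1) (n + 2)
  have e₁ : extM R M N (n + 1) ≅ S.homology :=
    P.isoExt (n + 1) (ModuleCat.of R N) ≪≫
      CategoryTheory.ShortComplex.homologyMapIso
        (K.isoSc' n (n + 1) (n + 2) (by simp) (by simp))
  have e : extM R M N (n + 1) ≃ₗ[R] (LinearMap.ker S.g.hom ⧸ LinearMap.range S.moduleCatToCycles) :=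
    (e₁ ≪≫ S.moduleCatHomologyIso).toLinearEquiv
  have hf : ∀ b : P.complex.X n ⟶ ModuleCat.of R N,
    S.f.hom b = P.complex.d (n + 1) n ≫ b := fun b => rfl
  have hg : ∀ c : P.complex.X (n + 1) ⟶ ModuleCat.of R N,
    S.g.hom c = P.complex.d (n + 2) (n + 1) ≫ c := fun b => rfl
  refine ⟨fun c => e.symm (Submodule.Quotient.mk ⟨c.1, ?_⟩), ?_, ?_, ?_⟩
  · exact LinearMap.mem_ker.2 ((hg _).trans c.2)
  · intro x
    obtain ⟨⟨y, hy⟩, hxy⟩ := Submodule.Quotient.mk_surjective _ (e x)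
    refine ⟨⟨y, (hg y).symm.trans hy⟩, ?_⟩
    simp only
    rw [LinearEquiv.symm_apply_eq, ← hxy]
  · intro r c c' h
    simp only
    rw [← map_smul, ← Submodule.Quotient.mk_smul]
    congr 3
  · intro c
    simp only [LinearEquiv.map_eq_zero_iff, Submodule.Quotient.mk_eq_zero, LinearMap.mem_range]
    constructor
    · rintro ⟨b, hb⟩
      exact ⟨b, (congrArg Subtype.val hb).symm⟩
    · rintro ⟨b, hb⟩
      exact ⟨b, Subtype.ext hb.symm⟩

theorem exists_comp_eq_of_ker_le {A B C : Type*} [AddCommGroup A] [Module R A] [AddCommGroup B]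
    [Module R B] [AddCommGroup C] [Module R C] (q : A →ₗ[R] B) (hq : Function.Surjective q)
    (m : A →ₗ[R] C) (h : ∀ a, q a = 0 → m a = 0) : ∃ f : B →ₗ[R] C, ∀ a, f (q a) = m a := by
  refine ⟨((LinearMap.ker q).liftQ m fun a ha => h a ha) ∘ₗ
    (q.quotKerEquivOfSurjective hq).symm.toLinearMap, fun a => ?_⟩
  have : (q.quotKerEquivOfSurjective hq).symm (q a) = Submodule.Quotient.mk a := by
    rw [LinearEquiv.symm_apply_eq]; rfl
  rw [LinearMap.comp_apply, LinearEquiv.coe_coe, this]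
  rfl

section Resolution

variable {M : Type} [AddCommGroup M] [Module R M] (P : ProjectiveResolution (ModuleCat.of R M))

/-- The augmentation of a projective resolution of a module, as a linear map. -/
noncomputable def CategoryTheory.ProjectiveResolution.augmentation : P.complex.X 0 →ₗ[R] M :=
  (P.π.f 0).hom

theorem CategoryTheory.ProjectiveResolution.augmentation_surjective :
    Function.Surjective P.augmentation :=
  (ModuleCat.epi_iff_surjective (P.π.f 0)).1 inferInstance

theorem CategoryTheory.ProjectiveResolution.augmentation_eq_zero_iff (x : P.complex.X 0) :
    P.augmentation x = 0 ↔ ∃ y, P.complex.d 1 0 y = x := by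
  constructor
  · exact (ShortComplex.moduleCat_exact_iff _).1 P.exact₀ x
  · rintro ⟨y, rfl⟩
    exact ConcreteCategory.congr_hom P.complex_d_comp_π_f_zero y

theorem CategoryTheory.ProjectiveResolution.d_eq_zero_iff (n : ℕ) (x : P.complex.X (n + 1)) :
    P.complex.d (n + 1) n x = 0 ↔ ∃ y, P.complex.d (n + 2) (n + 1) y = x := by
  constructor
  · exact (ShortComplex.moduleCat_exact_iff _).1 (P.exact_succ n) x
  · rintro ⟨y, rfl⟩
    exact ConcreteCategory.congr_hom (P.complex.d_comp_d (n + 2) (n + 1) n) y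

theorem CategoryTheory.ProjectiveResolution.module_projective (n : ℕ) :
    Module.Projective R (P.complex.X n) :=
  (IsProjective.iff_projective _).2 (P.projective n)

end Resolution

/-- Every map on the kernel of a surjection onto `M` has an obstruction in `Ext^1(M, N)`. -/
theorem exists_extM_obstruction {M N F : Type} [AddCommGroup M] [Module R M] [AddCommGroup N]
    [Module R N] [AddCommGroup F] [Module R F] (π : F →ₗ[R] M) (hπ : Function.Surjective π)
    (g : LinearMap.ker π →ₗ[R] N) :
    ∃ x : extM R M N 1, ∀ r : R, r • x = 0 →
      ∃ h : F →ₗ[R] N, ∀ k : LinearMap.ker π, h k = r • g k := by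
  let P := ProjectiveResolution.of (ModuleCat.of R M)
  obtain ⟨φ, -, hsmul, hzero⟩ := exists_cocycle_map N P 0
  have := P.module_projective 0
  obtain ⟨u, hu⟩ := Module.projective_lifting_property π P.augmentation hπ
  replace hu : ∀ p, π (u p) = P.augmentation p := fun p => LinearMap.congr_fun hu p
  have hd : ∀ y, u (P.complex.d 1 0 y) ∈ LinearMap.ker π := fun y => by
    rw [LinearMap.mem_ker, hu, P.augmentation_eq_zero_iff]; exact ⟨y, rfl⟩
  let d₁ : P.complex.X 1 →ₗ[R] LinearMap.ker π :=
    LinearMap.codRestrict _ (u ∘ₗ (P.complex.d 1 0).hom) hd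
  let c : P.complex.X 1 ⟶ ModuleCat.of R N := ModuleCat.ofHom (g ∘ₗ d₁)
  have hc : P.complex.d 2 1 ≫ c = 0 := by
    ext y
    have : P.complex.d 1 0 (P.complex.d 2 1 y) = 0 := (P.d_eq_zero_iff 0 _).2 ⟨y, rfl⟩
    have h2 : d₁ (P.complex.d 2 1 y) = 0 := by
      ext; change u (P.complex.d 1 0 (P.complex.d 2 1 y)) = 0; rw [this, map_zero]
    change g (d₁ (P.complex.d 2 1 y)) = 0
    rw [h2, map_zero]
  refine ⟨φ ⟨c, hc⟩, fun r hr => ?_⟩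
  rw [← hsmul r ⟨c, hc⟩ ⟨r • c, by rw [Linear.comp_smul, hc, smul_zero]⟩ rfl, hzero] at hr
  obtain ⟨b, hb⟩ := hr
  replace hb : ∀ y, r • g (d₁ y) = b (P.complex.d 1 0 y) := fun y =>
    ConcreteCategory.congr_hom hb y
  obtain ⟨h, hh⟩ := exists_comp_eq_of_ker_le
    (LinearMap.coprod u (LinearMap.ker π).subtype)
    (by
      intro x
      obtain ⟨p, hp⟩ := P.augmentation_surjective (π x)
      refine ⟨(p, ⟨x - u p, ?_⟩), ?_⟩
      · rw [LinearMap.mem_ker, map_sub, hu, hp, sub_self]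
      · simp)
    (LinearMap.coprod b.hom (r • g)) (by
      rintro ⟨p, k⟩ h0
      simp only [LinearMap.coprod_apply, Submodule.subtype_apply] at h0
      have : P.augmentation p = 0 := by
        rw [← hu, eq_neg_of_add_eq_zero_left h0, map_neg, LinearMap.mem_ker.1 k.2, neg_zero]
      obtain ⟨y, rfl⟩ := (P.augmentation_eq_zero_iff p).1 this
      have hk : d₁ y + k = 0 := Subtype.ext h0
      have := hb y
      change b (P.complex.d 1 0 y) + r • g k = 0
      rw [← this, ← smul_add, ← map_add, hk, map_zero, smul_zero])
  exact ⟨h, fun k => by simpa using hh (0, k)⟩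

/-- Every element of `Ext^1(M, N)` is the obstruction to extending some map. -/
theorem exists_extM_presentation {M N : Type} [AddCommGroup M] [Module R M] [AddCommGroup N]
    [Module R N] (x : extM R M N 1) :
    ∃ (F : Type) (_ : AddCommGroup F) (_ : Module R F) (π : F →ₗ[R] M)
      (g : LinearMap.ker π →ₗ[R] N), Function.Surjective π ∧ ∀ r : R,
      (∃ h : F →ₗ[R] N, ∀ k : LinearMap.ker π, h k = r • g k) → r • x = 0 := by
  let P := ProjectiveResolution.of (ModuleCat.of R M)
  obtain ⟨φ, hφ, hsmul, hzero⟩ := exists_cocycle_map N P 0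
  obtain ⟨⟨c, hc⟩, rfl⟩ := hφ x
  have hd : ∀ y, P.complex.d 1 0 y ∈ LinearMap.ker P.augmentation := fun y => by
    rw [LinearMap.mem_ker, P.augmentation_eq_zero_iff]; exact ⟨y, rfl⟩
  obtain ⟨g, hg⟩ := exists_comp_eq_of_ker_le
    (LinearMap.codRestrict (LinearMap.ker P.augmentation) (P.complex.d 1 0).hom hd)
    (by
      rintro ⟨p, hp⟩
      obtain ⟨y, rfl⟩ := (P.augmentation_eq_zero_iff p).1 hp
      exact ⟨y, rfl⟩) c.hom (by
      intro y hy
      have : P.complex.d 1 0 y = 0 := congrArg Subtype.val hy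
      obtain ⟨z, rfl⟩ := (P.d_eq_zero_iff 0 _).1 this
      exact ConcreteCategory.congr_hom hc z)
  refine ⟨P.complex.X 0, inferInstance, inferInstance, P.augmentation, g,
    P.augmentation_surjective, ?_⟩
  rintro r ⟨h, hh⟩
  rw [← hsmul r ⟨c, hc⟩ ⟨r • c, by rw [Linear.comp_smul, hc, smul_zero]⟩ rfl, hzero]
  refine ⟨ModuleCat.ofHom h, ?_⟩
  ext y
  have := hh ⟨_, hd y⟩
  exact ((congrArg (r • ·) (hg y)).symm.trans this.symm)

theorem subsingleton_extM_one_iff {M N : Type} [AddCommGroup M] [Module R M] [AddCommGroup N]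
    [Module R N] :
    Subsingleton (extM R M N 1) ↔
      ∀ (F : Type) [AddCommGroup F] [Module R F] (π : F →ₗ[R] M), Function.Surjective π →
        ∀ g : LinearMap.ker π →ₗ[R] N, ∃ h : F →ₗ[R] N, ∀ k : LinearMap.ker π, h k = g k := by
  constructor
  · intro hs F _ _ π hπ g
    obtain ⟨x, hx⟩ := exists_extM_obstruction π hπ g
    simpa using hx 1 (Subsingleton.elim _ _)
  · intro H
    refine subsingleton_of_forall_eq 0 fun x => ?_
    obtain ⟨F, _, _, π, g, hπ, hg⟩ := exists_extM_presentation x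
    simpa using hg 1 (by simpa using H F π hπ g)

end ExtBridge

section GVIdeals

variable {R : Type} [CommRing R]

theorem isGVIdeal_iff {J : Ideal R} : IsGVIdeal R J ↔ J.FG ∧ (∀ r : R, (∀ j ∈ J, j * r = 0) → r = 0) ∧
    ∀ h : J →ₗ[R] R, ∃ r : R, ∀ j : J, h j = j * r := by
  unfold IsGVIdeal
  refine and_congr_right fun _ => and_congr ?_ ?_
  · constructor
    · intro hinj r hr
      refine hinj (LinearMap.ext fun j => ?_)
      simpa [mul_comm r] using hr j j.2
    · intro H a b hab
      refine sub_eq_zero.1 (H _ fun j hj => ?_)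
      have := LinearMap.congr_fun hab ⟨j, hj⟩
      simp only [LinearMap.smul_apply, Submodule.subtype_apply, smul_eq_mul] at this
      linear_combination this
  · refine forall_congr' fun h => exists_congr fun r => ?_
    rw [LinearMap.ext_iff]
    refine forall_congr' fun j => ?_
    rw [eq_comm]
    simp [mul_comm r]

theorem isGVIdeal_top : IsGVIdeal R (⊤ : Ideal R) := by
  refine isGVIdeal_iff.2 ⟨⟨{1}, by simp⟩, fun r hr => by simpa using hr 1 trivial, fun h => ?_⟩
  refine ⟨h ⟨1, trivial⟩, fun j => ?_⟩
  rw [← smul_eq_mul, ← map_smul]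
  congr 1
  ext
  simp

theorem IsGVIdeal.mono {J J' : Ideal R} (hJ : IsGVIdeal R J) (hle : J ≤ J') (hfg : J'.FG) :
    IsGVIdeal R J' := by
  obtain ⟨-, hinj, hsurj⟩ := isGVIdeal_iff.1 hJ
  refine isGVIdeal_iff.2 ⟨hfg, fun r hr => hinj r fun j hj => hr j (hle hj), fun h => ?_⟩
  obtain ⟨r, hr⟩ := hsurj (h ∘ₗ Submodule.inclusion hle)
  refine ⟨r, fun x => sub_eq_zero.1 (hinj _ fun j hj => ?_)⟩
  have h1 : (j : R) * h x = x * h ⟨j, hle hj⟩ := by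
    rw [← smul_eq_mul, ← smul_eq_mul, ← map_smul, ← map_smul]
    congr 1
    ext
    simp [mul_comm]
  have h2 : h ⟨j, hle hj⟩ = j * r := hr ⟨j, hj⟩
  rw [mul_sub, h1, h2]
  ring

theorem IsGVIdeal.mul {J J' : Ideal R} (hJ : IsGVIdeal R J) (hJ' : IsGVIdeal R J') :
    IsGVIdeal R (J * J') := by
  obtain ⟨hfg, hinj, hsurj⟩ := isGVIdeal_iff.1 hJ
  obtain ⟨hfg', hinj', hsurj'⟩ := isGVIdeal_iff.1 hJ'
  refine isGVIdeal_iff.2 ⟨hfg.mul hfg', fun r hr => hinj _ fun j hj => hinj' _ fun j' hj' => ?_,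
    fun h => ?_⟩
  · rw [← mul_assoc, mul_comm j']
    exact hr _ (Ideal.mul_mem_mul hj hj')
  · let ψ : J → J' →ₗ[R] R := fun j =>
      { toFun := fun j' => h ⟨j * j', Ideal.mul_mem_mul j.2 j'.2⟩
        map_add' := fun a b => by
          rw [← map_add]; congr 1; ext; simp [mul_add]
        map_smul' := fun a b => by
          rw [RingHom.id_apply, ← map_smul]; congr 1; ext; simp; ring }
    choose k hk using fun j => hsurj' (ψ j)
    have huniq : ∀ a b : R, (∀ j' : J', (j' : R) * a = j' * b) → a = b := fun a b hab =>
      sub_eq_zero.1 (hinj' _ fun j' hj' => by rw [mul_sub, hab ⟨j', hj'⟩, sub_self])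
    let kl : J →ₗ[R] R :=
      { toFun := k
        map_add' := fun a b => huniq _ _ fun j' => by
          rw [← hk, mul_add, ← hk, ← hk]
          change h _ = h _ + h _
          rw [← map_add]; congr 1; ext; simp [add_mul]
        map_smul' := fun a b => huniq _ _ fun j' => by
          rw [← hk, RingHom.id_apply, smul_eq_mul, mul_left_comm, ← hk, ← smul_eq_mul]
          change h _ = a • h _
          rw [← map_smul]; congr 1; ext; simp [mul_assoc] }
    obtain ⟨r, hr⟩ := hsurj kl
    refine ⟨r, ?_⟩
    rintro ⟨x, hx⟩
    change h ⟨x, hx⟩ = x * r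
    induction hx using Submodule.mul_induction_on' with
    | mem_mul_mem a ha b hb =>
      have h1 : h ⟨a * b, Ideal.mul_mem_mul ha hb⟩ = b * k ⟨a, ha⟩ := hk ⟨a, ha⟩ ⟨b, hb⟩
      have h2 : k ⟨a, ha⟩ = a * r := hr ⟨a, ha⟩
      rw [h1, h2]
      ring
    | add a ha b hb iha ihb =>
      rw [add_mul, ← iha, ← ihb, ← map_add]
      rfl

theorem IsGVIdeal.pow {J : Ideal R} (hJ : IsGVIdeal R J) (n : ℕ) : IsGVIdeal R (J ^ n) := by
  induction n with
  | zero => rw [pow_zero, Ideal.one_eq_top]; exact isGVIdeal_top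
  | succ n ih => rw [pow_succ]; exact ih.mul hJ

theorem IsGVIdeal.prod {ι : Type*} {J : ι → Ideal R} (s : Finset ι)
    (hJ : ∀ i ∈ s, IsGVIdeal R (J i)) : IsGVIdeal R (∏ i ∈ s, J i) := by
  classical
  induction s using Finset.induction_on with
  | empty => rw [Finset.prod_empty, Ideal.one_eq_top]; exact isGVIdeal_top
  | insert i s hi ih =>
    rw [Finset.prod_insert hi]
    exact (hJ i (Finset.mem_insert_self i s)).mul
      (ih fun k hk => hJ k (Finset.mem_insert_of_mem hk))

section WClosure

variable {B : Type*} [AddCommGroup B] [Module R B]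

/-- The elements of `B` which some GV-ideal carries into the submodule `A`. -/
def wClosure (A : Submodule R B) : Submodule R B where
  carrier := {x | ∃ J : Ideal R, IsGVIdeal R J ∧ ∀ j ∈ J, j • x ∈ A}
  zero_mem' := ⟨⊤, isGVIdeal_top, fun j _ => by rw [smul_zero]; exact A.zero_mem⟩
  add_mem' := fun {x y} ⟨J, hJ, hx⟩ ⟨J', hJ', hy⟩ => ⟨J * J', hJ.mul hJ', fun j hj =>
    (smul_add j x y).symm ▸ A.add_mem (hx j (Ideal.mul_le_left hj))
      (hy j (Ideal.mul_le_right hj))⟩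
  smul_mem' := by
    rintro r x ⟨J, hJ, hx⟩
    exact ⟨J, hJ, fun j hj => by rw [smul_comm]; exact A.smul_mem r (hx j hj)⟩

theorem mem_wClosure {A : Submodule R B} {x : B} :
    x ∈ wClosure A ↔ ∃ J : Ideal R, IsGVIdeal R J ∧ ∀ j ∈ J, j • x ∈ A :=
  Iff.rfl

theorem le_wClosure (A : Submodule R B) : A ≤ wClosure A := fun _ hx =>
  ⟨⊤, isGVIdeal_top, fun j _ => A.smul_mem j hx⟩

theorem wClosure_wClosure (A : Submodule R B) : wClosure (wClosure A) = wClosure A := by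
  refine le_antisymm ?_ (le_wClosure _)
  rintro x ⟨J, hJ, hx⟩
  obtain ⟨s, rfl⟩ := id hJ.1
  choose! L hL hLx using hx
  have hsub : ∀ i ∈ s, i ∈ Ideal.span (s : Set R) := fun i hi => Ideal.subset_span hi
  refine ⟨(∏ i ∈ s, L i) * Ideal.span (s : Set R),
    (IsGVIdeal.prod s fun i hi => hL i (hsub i hi)).mul hJ, fun j hj => ?_⟩
  induction hj using Submodule.mul_induction_on' with
  | add a ha b hb iha ihb => rw [add_smul]; exact A.add_mem iha ihb
  | mem_mul_mem a ha b hb =>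
    induction hb using Submodule.span_induction with
    | mem b hb =>
      rw [mul_smul]
      exact hLx b (hsub b hb) a (Ideal.prod_le_inf.trans (Finset.inf_le hb) ha)
    | zero => simp
    | add b c hb hc ihb ihc => rw [mul_add, add_smul]; exact A.add_mem ihb ihc
    | smul r b hb ih =>
      rw [smul_eq_mul, mul_left_comm, mul_smul]
      exact A.smul_mem r ih

theorem isGVTorsion_quotient_iff {A : Submodule R B} :
    IsGVTorsion R (B ⧸ A) ↔ ∀ x, x ∈ wClosure A := by
  constructor
  · intro h x
    obtain ⟨J, hJ, hx⟩ := h (Submodule.Quotient.mk x)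
    refine ⟨J, hJ, fun j hj => ?_⟩
    have := hx j hj
    rwa [← Submodule.Quotient.mk_smul, Submodule.Quotient.mk_eq_zero] at this
  · intro h x
    obtain ⟨x, rfl⟩ := Submodule.Quotient.mk_surjective _ x
    obtain ⟨J, hJ, hx⟩ := h x
    refine ⟨J, hJ, fun j hj => ?_⟩
    rw [← Submodule.Quotient.mk_smul, Submodule.Quotient.mk_eq_zero]
    exact hx j hj

theorem isGVTorsionFree_quotient_iff {A : Submodule R B} :
    IsGVTorsionFree R (B ⧸ A) ↔ wClosure A = A := by
  constructor
  · intro h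
    refine le_antisymm ?_ (le_wClosure A)
    rintro x ⟨J, hJ, hx⟩
    refine (Submodule.Quotient.mk_eq_zero A).1 (h _ ⟨J, hJ, fun j hj => ?_⟩)
    rw [← Submodule.Quotient.mk_smul, Submodule.Quotient.mk_eq_zero]
    exact hx j hj
  · rintro h x ⟨J, hJ, hx⟩
    obtain ⟨x, rfl⟩ := Submodule.Quotient.mk_surjective _ x
    refine (Submodule.Quotient.mk_eq_zero A).2 (h.le ⟨J, hJ, fun j hj => ?_⟩)
    have := hx j hj
    rwa [← Submodule.Quotient.mk_smul, Submodule.Quotient.mk_eq_zero] at this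

theorem torGV_eq (M : Type) [AddCommGroup M] [Module R M] : torGV R M = wClosure ⊥ := by
  refine le_antisymm (Submodule.span_le.2 ?_) ?_
  · rintro x ⟨J, hJ, hx⟩
    exact ⟨J, hJ, fun j hj => (Submodule.mem_bot R).2 (hx j hj)⟩
  · rintro x ⟨J, hJ, hx⟩
    exact Submodule.subset_span ⟨J, hJ, fun j hj => (Submodule.mem_bot R).1 (hx j hj)⟩

theorem IsGVTorsionFree.of_injective {C : Type*} [AddCommGroup C] [Module R C]
    (hC : IsGVTorsionFree R C) (f : B →ₗ[R] C) (hf : Function.Injective f) :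
    IsGVTorsionFree R B := by
  rintro x ⟨J, hJ, hx⟩
  refine (map_eq_zero_iff f hf).1 (hC _ ⟨J, hJ, fun j hj => ?_⟩)
  rw [← map_smul, hx j hj, map_zero]

theorem isGVTorsionFree_pi (ι : Type*) : IsGVTorsionFree R (ι → R) := by
  rintro x ⟨J, hJ, hx⟩
  ext i
  exact (isGVIdeal_iff.1 hJ).2.1 _ fun j hj => congrFun (hx j hj) i

end WClosure

/-- A GV-torsion extension of the source of a map into a `w`-module does not obstruct extending
the map. -/
theorem IsWModule.exists_extension {N : Type} [AddCommGroup N] [Module R N] (hN : IsWModule R N)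
    {F : Type} [AddCommGroup F] [Module R F] (F₀ : Submodule R F) (hF : ∀ x, x ∈ wClosure F₀)
    (h₀ : F₀ →ₗ[R] N) : ∃ h : F →ₗ[R] N, ∀ x : F₀, h x = h₀ x := by
  let G₀ : Submodule R (F × N) := LinearMap.range (F₀.subtype.prod h₀)
  let G := wClosure G₀
  have hG₀ : ∀ x n, (x, n) ∈ G₀ ↔ ∃ hx : x ∈ F₀, h₀ ⟨x, hx⟩ = n := by
    intro x n
    constructor
    · rintro ⟨y, hy⟩
      obtain ⟨rfl, rfl⟩ := Prod.ext_iff.1 hy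
      exact ⟨y.2, rfl⟩
    · rintro ⟨hx, rfl⟩
      exact ⟨⟨x, hx⟩, rfl⟩
  have hinj : ∀ y ∈ G, y.1 = 0 → y = 0 := by
    rintro ⟨x, n⟩ ⟨J, hJ, hy⟩ rfl
    refine Prod.ext rfl (hN.1 _ ⟨J, hJ, fun j hj => ?_⟩)
    have h1 : ((0 : F), j • n) ∈ G₀ := by simpa using hy j hj
    obtain ⟨h0, h2⟩ := (hG₀ _ _).1 h1
    rw [← h2]
    exact map_zero h₀
  have hsurj : ∀ x, ∃ n, (x, n) ∈ G := by
    intro x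
    obtain ⟨J, hJ, hx⟩ := hF x
    obtain ⟨h, hh⟩ := subsingleton_extM_one_iff.1 (hN.2 J hJ) R J.mkQ J.mkQ_surjective
      (h₀ ∘ₗ LinearMap.codRestrict F₀
        ((LinearMap.toSpanSingleton R F x) ∘ₗ (LinearMap.ker J.mkQ).subtype) (by
          rintro ⟨j, hj⟩
          rw [Submodule.ker_mkQ] at hj
          exact hx j hj))
    refine ⟨h 1, J, hJ, fun j hj => (hG₀ _ _).2 ⟨hx j hj, ?_⟩⟩
    have h1 := hh ⟨j, by rwa [Submodule.ker_mkQ]⟩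
    rw [← map_smul, smul_eq_mul, mul_one]
    exact h1.symm
  obtain ⟨h, hh⟩ := exists_comp_eq_of_ker_le (LinearMap.fst R F N ∘ₗ G.subtype)
    (fun x => by
      obtain ⟨n, hn⟩ := hsurj x
      exact ⟨⟨_, hn⟩, rfl⟩)
    (LinearMap.snd R F N ∘ₗ G.subtype) (fun y hy => by
      have := hinj y y.2 hy
      simp [this])
  refine ⟨h, fun x => ?_⟩
  exact hh ⟨(x, h₀ x), le_wClosure _ ((hG₀ _ _).2 ⟨x.2, rfl⟩)⟩

end GVIdeals

section MaximalWIdeals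

variable {R : Type} [CommRing R]

theorem isWIdeal_iff {I : Ideal R} : IsWIdeal R I ↔ wClosure I = I :=
  ⟨fun h => le_antisymm (fun x hx => h x hx) (le_wClosure I), fun h _ hx => h.le hx⟩

theorem IsMaxWIdeal.isPrime {P : Ideal R} (hP : IsMaxWIdeal R P) : P.IsPrime := by
  refine ⟨hP.2.1, fun {a b} hab => or_iff_not_imp_left.2 fun ha => ?_⟩
  have htop : wClosure (P ⊔ Ideal.span {a}) = ⊤ := by
    by_contra hne
    refine ha ((hP.2.2 _ (isWIdeal_iff.2 (wClosure_wClosure _)) hne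
      (le_sup_left.trans (le_wClosure _))).le (le_wClosure _ (le_sup_right (a := P) ?_)))
    exact Ideal.mem_span_singleton_self a
  obtain ⟨J, hJ, h⟩ := (Submodule.eq_top_iff'.1 htop (1 : R))
  refine hP.1 b ⟨J, hJ, fun j hj => ?_⟩
  have hj' : j ∈ P ⊔ Ideal.span {a} := by simpa using h j hj
  obtain ⟨p, hp, c, hc, rfl⟩ := Submodule.mem_sup.1 hj'
  obtain ⟨c, rfl⟩ := Ideal.mem_span_singleton'.1 hc
  rw [add_mul, mul_assoc]
  exact P.add_mem (P.mul_mem_right _ hp) (P.mul_mem_left _ hab)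

theorem exists_le_isMaxWIdeal {A : Ideal R} (hA : wClosure A ≠ ⊤) :
    ∃ P : Ideal R, IsMaxWIdeal R P ∧ A ≤ P := by
  have hub : ∀ c ⊆ {I : Ideal R | IsWIdeal R I ∧ I ≠ ⊤}, IsChain (· ≤ ·) c → ∀ y ∈ c,
      ∃ ub ∈ {I : Ideal R | IsWIdeal R I ∧ I ≠ ⊤}, ∀ z ∈ c, z ≤ ub := by
    intro c hc hchain y hy
    have hmem : ∀ x, x ∈ sSup c ↔ ∃ I ∈ c, x ∈ I := fun x =>
      Submodule.mem_sSup_of_directed ⟨y, hy⟩ hchain.directedOn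
    refine ⟨sSup c, ⟨?_, fun htop => ?_⟩, fun z hz => le_sSup hz⟩
    · rintro x ⟨J, hJ, hx⟩
      obtain ⟨s, rfl⟩ := id hJ.1
      have hfin : ∀ t : Finset R, (∀ j ∈ t, j * x ∈ sSup c) → ∃ I ∈ c, ∀ j ∈ t, j * x ∈ I := by
        intro t
        classical
        induction t using Finset.induction_on with
        | empty => exact fun _ => ⟨y, hy, by simp⟩
        | insert a t _ ih =>
          intro ht
          obtain ⟨I, hI, hIt⟩ := ih fun j hj => ht j (Finset.mem_insert_of_mem hj)
          obtain ⟨I', hI', ha⟩ := (hmem _).1 (ht a (Finset.mem_insert_self a t))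
          obtain ⟨K, hK, hIK, hIK'⟩ := hchain.directedOn I hI I' hI'
          refine ⟨K, hK, fun j hj => ?_⟩
          rcases Finset.mem_insert.1 hj with rfl | hj
          · exact hIK' ha
          · exact hIK (hIt j hj)
      obtain ⟨I, hI, hsI⟩ := hfin s fun j hj => hx j (Ideal.subset_span hj)
      have hle : Ideal.span (s : Set R) ≤ Submodule.comap (LinearMap.toSpanSingleton R R x) I :=
        Ideal.span_le.2 hsI
      exact (hmem x).2 ⟨I, hI, (hc hI).1 x ⟨_, hJ, fun j hj => hle hj⟩⟩
    · obtain ⟨I, hI, h1⟩ := (hmem 1).1 (htop ▸ Submodule.mem_top)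
      exact (hc hI).2 ((Ideal.eq_top_iff_one I).2 h1)
  obtain ⟨P, hAP, hP⟩ := zorn_le_nonempty₀ _ hub (wClosure A)
    ⟨isWIdeal_iff.2 (wClosure_wClosure A), hA⟩
  refine ⟨P, ⟨hP.prop.1, hP.prop.2, fun I hI hne hle => ?_⟩, (le_wClosure A).trans hAP⟩
  exact (hP.eq_of_le ⟨hI, hne⟩ hle).symm

theorem IsWEpi.mem_wClosure_range {A B : Type} [AddCommGroup A] [Module R A] [AddCommGroup B]
    [Module R B] {f : A →ₗ[R] B} (hf : IsWEpi R f) (x : B) : x ∈ wClosure (LinearMap.range f) := by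
  let I : Ideal R := (LinearMap.range f).comap (LinearMap.toSpanSingleton R B x)
  have hI : ∀ r, r ∈ I ↔ r • x ∈ LinearMap.range f := fun r => Iff.rfl
  by_contra hx
  have hne : wClosure I ≠ ⊤ := fun htop => by
    obtain ⟨J, hJ, h⟩ := Submodule.eq_top_iff'.1 htop (1 : R)
    exact hx ⟨J, hJ, fun j hj => (hI j).1 (by simpa using h j hj)⟩
  obtain ⟨P, hP, hIP⟩ := exists_le_isMaxWIdeal hne
  have := hP.isPrime
  obtain ⟨y, hy⟩ := hf P hP (LocalizedModule.mkLinearMap P.primeCompl B x)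
  obtain ⟨⟨a, s⟩, rfl⟩ := IsLocalizedModule.mk'_surjective P.primeCompl
    (LocalizedModule.mkLinearMap P.primeCompl A) y
  rw [Function.uncurry_apply_pair, locMap, IsLocalizedModule.map_mk',
    IsLocalizedModule.mk'_eq_iff, Submonoid.smul_def, ← map_smul,
    IsLocalizedModule.eq_iff_exists P.primeCompl] at hy
  obtain ⟨t, ht⟩ := hy
  refine (t * s).2 (hIP ((hI _).2 ⟨t • a, ?_⟩))
  rw [Submonoid.smul_def, map_smul, ← Submonoid.smul_def, ht]
  simp [Submonoid.smul_def, mul_smul]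

theorem isFiniteType_of_fg {M : Type} [AddCommGroup M] [Module R M] [Module.Finite R M] :
    IsFiniteType R M := by
  obtain ⟨n, f, hf⟩ := Module.Finite.exists_fin' R M
  exact ⟨n, f, fun P _ _ => IsLocalizedModule.map_surjective _ _ _ f hf⟩

end MaximalWIdeals

section FactorsThroughFree

variable {R : Type} [CommRing R]

/-- Multiplication by `r` on `M` factors through a finitely generated free module. -/
def FactorsThroughFree (M : Type) [AddCommGroup M] [Module R M] (r : R) : Prop :=
  ∃ (n : ℕ) (f : M →ₗ[R] Fin n → R) (g : (Fin n → R) →ₗ[R] M), ∀ x, g (f x) = r • x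

theorem factorsThroughFree_of_finite {M F : Type} [AddCommGroup M] [Module R M] [AddCommGroup F]
    [Module R F] [Module.Free R F] [Module.Finite R F] {r : R} (f : M →ₗ[R] F) (g : F →ₗ[R] M)
    (h : ∀ x, g (f x) = r • x) : FactorsThroughFree M r := by
  let b := (Module.Free.chooseBasis R F).reindex (Fintype.equivFin _)
  exact ⟨_, b.equivFun.toLinearMap ∘ₗ f, g ∘ₗ b.equivFun.symm.toLinearMap, by simp [h]⟩

/-- The ideal of the `r` such that multiplication by `r` on `M` factors through a finitely generated
free module. -/
def freeFactorIdeal (M : Type) [AddCommGroup M] [Module R M] : Ideal R where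
  carrier := {r | FactorsThroughFree M r}
  zero_mem' := ⟨0, 0, 0, by simp⟩
  add_mem' := by
    rintro a b ⟨n, f, g, h⟩ ⟨n', f', g', h'⟩
    exact factorsThroughFree_of_finite (f.prod f') (g.coprod g') fun x => by simp [h, h', add_smul]
  smul_mem' := by
    rintro c a ⟨n, f, g, h⟩
    exact ⟨n, f, c • g, fun x => by simp [h, mul_smul]⟩

theorem FactorsThroughFree.congr {M M' : Type} [AddCommGroup M] [Module R M] [AddCommGroup M']
    [Module R M'] (e : M ≃ₗ[R] M') {r : R} (h : FactorsThroughFree M r) :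
    FactorsThroughFree M' r := by
  obtain ⟨n, f, g, h⟩ := h
  exact ⟨n, f ∘ₗ e.symm.toLinearMap, e.toLinearMap ∘ₗ g, fun x => by simp [h]⟩

/-- `M` is a direct summand of a finitely generated free module up to GV-torsion. -/
def IsGVProjective (R : Type) [CommRing R] (M : Type) [AddCommGroup M] [Module R M] : Prop :=
  ∃ J : Ideal R, IsGVIdeal R J ∧ ∀ j ∈ J, FactorsThroughFree M j

theorem isGVProjective_iff {M : Type} [AddCommGroup M] [Module R M] :
    IsGVProjective R M ↔ (1 : R) ∈ wClosure (freeFactorIdeal (R := R) M) := by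
  simp only [mem_wClosure, smul_eq_mul, mul_one]
  rfl

theorem IsGVProjective.congr {M M' : Type} [AddCommGroup M] [Module R M] [AddCommGroup M']
    [Module R M'] (e : M ≃ₗ[R] M') (h : IsGVProjective R M) : IsGVProjective R M' := by
  obtain ⟨J, hJ, h⟩ := h
  exact ⟨J, hJ, fun j hj => (h j hj).congr e⟩

/-- If finitely generated ideals are projective up to GV-torsion then so are finitely generated
submodules of finite free modules. -/
theorem isGVProjective_of_injective (H : ∀ I : Ideal R, I.FG → IsGVProjective R I) (n : ℕ) :
    ∀ (M : Type) [AddCommGroup M] [Module R M] [Module.Finite R M] (i : M →ₗ[R] Fin n → R),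
      Function.Injective i → IsGVProjective R M := by
  induction n with
  | zero =>
    intro M _ _ _ i hi
    have : Subsingleton M := hi.subsingleton
    exact ⟨⊤, isGVIdeal_top, fun j _ => ⟨0, 0, 0, fun x => Subsingleton.elim _ _⟩⟩
  | succ n ih =>
    intro M _ _ _ i hi
    let p₀ : M →ₗ[R] R := LinearMap.proj 0 ∘ₗ i
    let tail : M →ₗ[R] Fin n → R := LinearMap.funLeft R R Fin.succ ∘ₗ i
    have htail : ∀ x, p₀ x = 0 → tail x = 0 → x = 0 := fun x h0 h1 => by
      refine (map_eq_zero_iff i hi).1 (funext fun k => ?_)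
      refine Fin.cases h0 (fun k => congrFun h1 k) k
    let I : Ideal R := LinearMap.range p₀
    let p : M →ₗ[R] I := p₀.rangeRestrict
    have hp : Function.Surjective p := LinearMap.surjective_rangeRestrict p₀
    obtain ⟨J, hJ, hI⟩ := H I (Module.Finite.iff_fg.1 (Module.Finite.range p₀))
    rw [isGVProjective_iff, ← wClosure_wClosure]
    refine ⟨J, hJ, fun j hj => ?_⟩
    obtain ⟨m, f, g, hfg⟩ := hI j hj
    obtain ⟨g', hg'⟩ := Module.projective_lifting_property p g hp
    replace hg' : ∀ x, p (g' x) = g x := fun x => LinearMap.congr_fun hg' x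
    let q : M →ₗ[R] M := j • LinearMap.id - g' ∘ₗ f ∘ₗ p
    have hq : ∀ x, q x = j • x - g' (f (p x)) := fun x => rfl
    have hpq : ∀ x, p₀ (q x) = 0 := fun x => by
      change ((p (q x) : I) : R) = 0
      rw [hq, map_sub, hg', hfg, map_smul, sub_self, Submodule.coe_zero]
    obtain ⟨J', hJ', hK⟩ := ih (LinearMap.range q) (tail ∘ₗ (LinearMap.range q).subtype) (by
      rw [injective_iff_map_eq_zero]
      rintro ⟨_, x, rfl⟩ hx
      exact Subtype.ext (htail _ (hpq x) hx))
    refine ⟨J', hJ', fun j' hj' => ?_⟩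
    obtain ⟨m', f', k, hk⟩ := hK j' hj'
    have hmul : j' • j • (1 : R) = j' * j := by simp
    rw [hmul]
    refine factorsThroughFree_of_finite ((f ∘ₗ p).prod (f' ∘ₗ q.rangeRestrict))
      ((j' • g').coprod ((LinearMap.range q).subtype ∘ₗ k)) fun x => ?_
    have h1 : ((k (f' (q.rangeRestrict x)) : LinearMap.range q) : M) = j' • q x := by
      rw [hk]; rfl
    change j' • g' (f (p x)) + ((k (f' (q.rangeRestrict x)) : LinearMap.range q) : M) = _
    rw [h1, hq, mul_smul, smul_sub, add_sub_cancel]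

theorem exists_injective_pi_of_fg {F : Type} [AddCommGroup F] [Module R F] [Module.Free R F]
    {N : Submodule R F} (hN : N.FG) :
    ∃ (n : ℕ) (i : N →ₗ[R] Fin n → R), Function.Injective i := by
  classical
  let b := Module.Free.chooseBasis R F
  obtain ⟨s, rfl⟩ := hN
  let t : Finset (Module.Free.ChooseBasisIndex R F) := s.biUnion fun x => (b.repr x).support
  let φ : F →ₗ[R] t → R := LinearMap.pi fun k => b.coord k
  have hφ : ∀ x ∈ Submodule.span R (s : Set F), φ x = 0 → x = 0 := by
    intro x hx h0
    have hsupp : ∀ k, k ∉ t → b.coord k x = 0 := by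
      intro k hk
      have : Submodule.span R (s : Set F) ≤ LinearMap.ker (b.coord k) := by
        refine Submodule.span_le.2 fun y hy => ?_
        have : k ∉ (b.repr y).support := fun h => hk (Finset.mem_biUnion.2 ⟨y, hy, h⟩)
        simpa using this
      exact this hx
    refine (b.forall_coord_eq_zero_iff).1 fun k => ?_
    by_cases hk : k ∈ t
    · exact congrFun h0 ⟨k, hk⟩
    · exact hsupp k hk
  refine ⟨t.card, (LinearMap.funLeft R R t.equivFin.symm) ∘ₗ φ ∘ₗ Submodule.subtype _, ?_⟩
  rw [injective_iff_map_eq_zero]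
  rintro ⟨x, hx⟩ h
  refine Subtype.ext (hφ x hx (funext fun k => ?_))
  simpa using congrFun h (t.equivFin k)

theorem Module.Free.isGVTorsionFree {F : Type} [AddCommGroup F] [Module R F] [Module.Free R F] :
    IsGVTorsionFree R F := by
  rintro x ⟨J, hJ, hx⟩
  refine ((Module.Free.chooseBasis R F).forall_coord_eq_zero_iff).1 fun k => ?_
  refine (isGVIdeal_iff.1 hJ).2.1 _ fun j hj => ?_
  rw [← smul_eq_mul, ← map_smul, hx j hj, map_zero]

/-- A GV-torsion-free module with a submodule that is projective and dense up to GV-torsion is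
`w`-projective. -/
theorem isWProjective_of_isGVProjective {M : Type} [AddCommGroup M] [Module R M]
    (hM : IsGVTorsionFree R M) (M₀ : Submodule R M) (h₀ : IsGVProjective R M₀)
    (hdense : ∀ x, x ∈ wClosure M₀) : IsWProjective R M := by
  intro N _ _ _ hN L _ _ ι hL x
  obtain ⟨J, hJ, hfac⟩ := h₀
  refine ⟨J, hJ, fun j hj => ?_⟩
  obtain ⟨F, _, _, π, g, hπ, hg⟩ := exists_extM_presentation x
  refine hg j ?_
  have htor : torGV R M = ⊥ := by
    rw [torGV_eq]
    refine eq_bot_iff.2 fun y hy => (Submodule.mem_bot R).2 (hM y ?_)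
    simpa [mem_wClosure] using hy
  let κ : M →ₗ[R] L := ι ∘ₗ (torGV R M).mkQ
  have hκ : Function.Injective κ := by
    refine hL.2.1.comp ?_
    rw [← LinearMap.ker_eq_bot, Submodule.ker_mkQ, htor]
  have hκdense : ∀ y, y ∈ wClosure (M₀.map κ) := by
    intro y
    rw [← wClosure_wClosure]
    obtain ⟨J', hJ', hy⟩ := isGVTorsion_quotient_iff.1 hL.2.2 y
    refine ⟨J', hJ', fun j' hj' => ?_⟩
    obtain ⟨z, hz⟩ := hy j' hj'
    obtain ⟨z, rfl⟩ := Submodule.mkQ_surjective _ z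
    rw [← hz]
    obtain ⟨J₂, hJ₂, hz₂⟩ := hdense z
    refine ⟨J₂, hJ₂, fun j₂ hj₂ => ⟨j₂ • z, hz₂ j₂ hj₂, ?_⟩⟩
    simp [κ]
  let e : M₀ ≃ₗ[R] M₀.map κ := Submodule.equivMapOfInjective κ hκ M₀
  obtain ⟨n, f, g', hfg⟩ := (hfac j hj).congr e
  let F₀ : Submodule R F := (M₀.map κ).comap π
  let π₀ : F₀ →ₗ[R] M₀.map κ := π.restrict fun y hy => hy
  have hπ₀ : Function.Surjective π₀ := by
    rintro ⟨y, hy⟩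
    obtain ⟨z, rfl⟩ := hπ y
    exact ⟨⟨z, hy⟩, rfl⟩
  obtain ⟨l, hl⟩ := Module.projective_lifting_property π₀ g' hπ₀
  replace hl : ∀ y, π₀ (l y) = g' y := fun y => LinearMap.congr_fun hl y
  let q : F₀ →ₗ[R] LinearMap.ker π := LinearMap.codRestrict _
    (F₀.subtype ∘ₗ (j • LinearMap.id - l ∘ₗ f ∘ₗ π₀)) (by
      intro y
      change ((π₀ (j • y - l (f (π₀ y))) : M₀.map κ) : L) = 0
      rw [map_sub, map_smul, hl, hfg, sub_self, Submodule.coe_zero])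
  obtain ⟨h, hh⟩ := hN.exists_extension F₀ (by
    intro y
    obtain ⟨J', hJ', hy⟩ := hκdense (π y)
    exact ⟨J', hJ', fun j' hj' => by
      change π (j' • y) ∈ M₀.map κ
      rw [map_smul]
      exact hy j' hj'⟩) (g ∘ₗ q)
  refine ⟨h, fun k => ?_⟩
  have hk : (k : F) ∈ F₀ := by
    change π k ∈ M₀.map κ
    rw [LinearMap.mem_ker.1 k.2]
    exact zero_mem _
  rw [hh ⟨k, hk⟩, LinearMap.comp_apply, ← map_smul]
  congr 1
  have : π₀ ⟨k, hk⟩ = 0 := Subtype.ext (LinearMap.mem_ker.1 k.2)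
  ext
  simp [q, this]

theorem isWProjective_of_isFiniteType (H : ∀ I : Ideal R, I.FG → IsGVProjective R I) {F : Type}
    [AddCommGroup F] [Module R F] [Module.Free R F] (N : Submodule R F) (hN : IsFiniteType R N) :
    IsWProjective R N := by
  obtain ⟨n, g, hg⟩ := hN
  obtain ⟨m, i, hi⟩ := exists_injective_pi_of_fg
    (N := (LinearMap.range g).map N.subtype) ((Module.Finite.iff_fg.1 (Module.Finite.range g)).map _)
  let e := Submodule.equivMapOfInjective N.subtype N.injective_subtype (LinearMap.range g)
  have : Module.Finite R (LinearMap.range g) := Module.Finite.range g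
  exact isWProjective_of_isGVProjective
    (Module.Free.isGVTorsionFree.of_injective N.subtype N.injective_subtype) (LinearMap.range g)
    (isGVProjective_of_injective H m (LinearMap.range g) (i ∘ₗ e.toLinearMap)
      (hi.comp e.injective)) hg.mem_wClosure_range

end FactorsThroughFree

section NagataRing

open Polynomial

variable {R : Type} [CommRing R]

theorem contentIdeal_le_iff {p : R[X]} {I : Ideal R} :
    p.contentIdeal ≤ I ↔ ∀ n, p.coeff n ∈ I := by
  refine ⟨fun h n => h (coeff_mem_contentIdeal p n), fun h => ?_⟩
  rw [contentIdeal_def, Ideal.span_le]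
  intro a ha
  obtain ⟨n, -, rfl⟩ := mem_coeffs_iff.1 ha
  exact h n

/-- The polynomials whose coefficients generate a GV-ideal. -/
def gvPolynomials (R : Type) [CommRing R] : Submonoid R[X] where
  carrier := {f | IsGVIdeal R f.contentIdeal}
  one_mem' := by
    rw [Set.mem_ofPred_eq, contentIdeal_one]
    exact isGVIdeal_top
  mul_mem' := by
    intro f g hf hg
    obtain ⟨n, hn⟩ := Ideal.exists_pow_le_of_le_radical_of_fg
      (mul_contentIdeal_le_radical_contentIdeal_mul (p := f) (q := g))
      ((contentIdeal_FG f).mul (contentIdeal_FG g))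
    exact ((IsGVIdeal.mul hf hg).pow n).mono hn (contentIdeal_FG _)

theorem IsGVIdeal.exists_le_contentIdeal {J : Ideal R} (hJ : IsGVIdeal R J) :
    ∃ f ∈ gvPolynomials R, ∀ n, f.coeff n ∈ J := by
  classical
  obtain ⟨n, v, rfl⟩ := Submodule.fg_iff_exists_fin_generating_family.1 hJ.1
  refine ⟨ofFn n v, ?_, fun i => ?_⟩
  · refine hJ.mono (Submodule.span_le.2 ?_) (contentIdeal_FG _)
    rintro _ ⟨i, rfl⟩
    rw [← ofFn_coeff_eq_val_of_lt v i.2]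
    exact coeff_mem_contentIdeal _ _
  · rcases lt_or_ge i n with hi | hi
    · rw [ofFn_coeff_eq_val_of_lt v hi]
      exact Submodule.subset_span ⟨_, rfl⟩
    · rw [ofFn_coeff_eq_zero_of_ge v hi]
      exact Submodule.zero_mem _

/-- The `w`-Nagata ring of `R`. -/
abbrev NagataRing (R : Type) [CommRing R] : Type := Localization (gvPolynomials R)

instance : Module.Flat R (NagataRing R) :=
  have := IsLocalization.flat (NagataRing R) (gvPolynomials R)
  Module.Flat.trans R R[X] (NagataRing R)

section NagataModules

variable {N : Type} [AddCommGroup N] [Module R N] [Module (NagataRing R) N]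
  [IsScalarTower R (NagataRing R) N]

theorem isGVTorsionFree_of_nagataRing : IsGVTorsionFree R N := by
  rintro x ⟨J, hJ, hx⟩
  obtain ⟨f, hf, hfJ⟩ := hJ.exists_le_contentIdeal
  have h0 : algebraMap R[X] (NagataRing R) f • x = 0 := by
    rw [f.as_sum_range, map_sum, Finset.sum_smul]
    refine Finset.sum_eq_zero fun i _ => ?_
    rw [← C_mul_X_pow_eq_monomial, mul_comm, map_mul, mul_smul, ← algebraMap_eq,
      ← IsScalarTower.algebraMap_apply, algebraMap_smul (NagataRing R) _ x, hx _ (hfJ i),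
      smul_zero]
  exact ((IsLocalization.map_units (NagataRing R)
    (⟨f, hf⟩ : gvPolynomials R)).smul_eq_zero).1 h0

theorem exists_extension_of_nagataRing {F : Type} [AddCommGroup F] [Module R F]
    {K : Submodule R F} (g : K →ₗ[R] N) {J : Ideal R} (hJ : IsGVIdeal R J)
    (hg : ∀ j ∈ J, ∃ h : F →ₗ[R] N, ∀ k : K, h k = j • g k) :
    ∃ h : F →ₗ[R] N, ∀ k : K, h k = g k := by
  let res : (F →ₗ[R] N) →ₗ[NagataRing R] (K →ₗ[R] N) :=
    { toFun := fun h => h ∘ₗ K.subtype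
      map_add' := fun _ _ => rfl
      map_smul' := fun _ _ => rfl }
  have h0 : (Submodule.Quotient.mk g : (K →ₗ[R] N) ⧸ LinearMap.range res) = 0 := by
    refine isGVTorsionFree_of_nagataRing _ ⟨J, hJ, fun j hj => ?_⟩
    rw [← Submodule.Quotient.mk_smul, Submodule.Quotient.mk_eq_zero]
    obtain ⟨h, hh⟩ := hg j hj
    exact ⟨h, LinearMap.ext hh⟩
  obtain ⟨h, hh⟩ := (Submodule.Quotient.mk_eq_zero _).1 h0
  exact ⟨h, fun k => LinearMap.congr_fun hh k⟩

theorem smul_mem_ker {J : Ideal R} {F : Type*} [AddCommGroup F] [Module R F] (π : F →ₗ[R] R ⧸ J)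
    (x : F) {j : R} (hj : j ∈ J) : j • x ∈ LinearMap.ker π := by
  obtain ⟨r, hr⟩ := Submodule.Quotient.mk_surjective _ (π x)
  rw [LinearMap.mem_ker, map_smul, ← hr, ← Submodule.Quotient.mk_smul,
    Submodule.Quotient.mk_eq_zero]
  exact J.mul_mem_right _ hj

theorem isWModule_of_nagataRing : IsWModule R N := by
  refine ⟨isGVTorsionFree_of_nagataRing, fun J hJ => subsingleton_extM_one_iff.2 ?_⟩
  intro F _ _ π _ g
  refine exists_extension_of_nagataRing g hJ fun j hj => ?_
  refine ⟨g ∘ₗ LinearMap.codRestrict _ (j • LinearMap.id) fun x => smul_mem_ker π x hj, fun k => ?_⟩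
  rw [← map_smul]
  rfl

theorem exists_injective_of_nagataRing (N : Type) [AddCommGroup N] [Module (NagataRing R) N] :
    ∃ (E : Type) (_ : AddCommGroup E) (_ : Module (NagataRing R) E) (i : N →ₗ[NagataRing R] E),
      Function.Injective i ∧ Module.Injective (NagataRing R) E := by
  obtain ⟨⟨E, hE, i, hi⟩⟩ := EnoughInjectives.presentation (ModuleCat.of (NagataRing R) N)
  have : CategoryTheory.Injective (ModuleCat.of (NagataRing R) E) := hE
  exact ⟨E, inferInstance, inferInstance, i.hom, (ModuleCat.mono_iff_injective i).1 hi,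
    Module.injective_module_of_injective_object _ _⟩

theorem Module.Injective.exists_extension_of_flat {S E A B : Type} [CommRing S] [Algebra R S]
    [Module.Flat R S] [AddCommGroup E] [Module S E] [Module R E] [IsScalarTower R S E]
    [Module.Injective S E] [AddCommGroup A] [Module R A] [AddCommGroup B] [Module R B]
    (i : A →ₗ[R] B) (hi : Function.Injective i) (g : A →ₗ[R] E) :
    ∃ h : B →ₗ[R] E, ∀ a, h (i a) = g a := by
  obtain ⟨h, hh⟩ := Module.Injective.out (i.baseChange S)
    (Module.Flat.lTensor_preserves_injective_linearMap i hi) (g.liftBaseChange S)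
  refine ⟨h.restrictScalars R ∘ₗ TensorProduct.mk R S B 1, fun a => ?_⟩
  simpa using hh (1 ⊗ₜ[R] a)

end NagataModules

section McCoy

variable {M : Type} [AddCommGroup M] [Module R M]

theorem smul_polynomialModule_eq_zero (hM : IsGVTorsionFree R M) {f : R[X]}
    (hf : f ∈ gvPolynomials R) (y : PolynomialModule R M) (hy : f • y = 0) : y = 0 := by
  obtain ⟨m, hm⟩ : ∃ m, ∀ n ≥ m, y.coeff n = 0 := by
    refine ⟨y.coeff.support.sup id + 1, fun n hn => Finsupp.notMem_support_iff.1 fun h => ?_⟩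
    exact absurd (Finset.le_sup (f := id) h) (by simp only [id]; omega)
  induction m generalizing y with
  | zero => exact PolynomialModule.coeff_injective (Finsupp.ext fun n => hm n n.zero_le)
  | succ m ih =>
    have key : ∀ d i, f.natDegree < i + d → f.coeff i • y = 0 := by
      intro d
      induction d with
      | zero => intro i hi; rw [coeff_eq_zero_of_natDegree_lt (by simpa using hi), zero_smul]
      | succ d ihd =>
        intro i hi
        refine ih _ ?_ fun n hn => ?_
        · rw [smul_comm, hy, smul_zero]
        · have hcoeff : ∀ n, (f.coeff i • y).coeff n = f.coeff i • y.coeff n := fun n => rfl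
          rw [hcoeff]
          rcases eq_or_lt_of_le hn with rfl | hn
          · have h1 : (f • y).coeff (i + m) = 0 := by rw [hy]; rfl
            rw [PolynomialModule.smul_apply, Finset.sum_eq_single (i, m)] at h1
            · exact h1
            · rintro ⟨p, q⟩ hpq hne
              rw [Finset.HasAntidiagonal.mem_antidiagonal] at hpq
              simp only at hpq ⊢
              rcases lt_trichotomy p i with hp | rfl | hp
              · rw [hm q (by omega), smul_zero]
              · exact absurd (by rw [show q = m by omega]) hne
              · exact DFunLike.congr_fun (congrArg PolynomialModule.coeff
                  (ihd p (by omega))) q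
            · intro h
              exact absurd (Finset.HasAntidiagonal.mem_antidiagonal (a := (i, m)).2 rfl) h
          · rw [hm n hn, smul_zero]
    refine PolynomialModule.coeff_injective (Finsupp.ext fun n => hM _ ⟨_, hf, fun a ha => ?_⟩)
    have hle : f.contentIdeal ≤ LinearMap.ker (LinearMap.toSpanSingleton R (PolynomialModule R M) y) :=
      contentIdeal_le_iff.2 fun i => key (f.natDegree + 1) i (by omega)
    exact DFunLike.congr_fun (congrArg PolynomialModule.coeff (hle ha)) n

variable (M) in
/-- The base change of an `R`-module to the `w`-Nagata ring. -/
abbrev NagataModule : Type := LocalizedModule (gvPolynomials R) (PolynomialModule R M)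

theorem mkLinearMap_nagata_injective (hM : IsGVTorsionFree R M) :
    Function.Injective
      (LocalizedModule.mkLinearMap (gvPolynomials R) (PolynomialModule R M)) := by
  rw [injective_iff_map_eq_zero]
  intro y hy
  rw [← map_zero (LocalizedModule.mkLinearMap (gvPolynomials R) (PolynomialModule R M)),
    IsLocalizedModule.eq_iff_exists (gvPolynomials R)] at hy
  obtain ⟨c, hc⟩ := hy
  rw [smul_zero] at hc
  exact smul_polynomialModule_eq_zero hM c.2 y hc

variable (R M) in
/-- The canonical map from a module to its base change to the `w`-Nagata ring. -/
noncomputable def toNagataModule : M →ₗ[R] NagataModule (R := R) M :=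
  (LocalizedModule.mkLinearMap (gvPolynomials R) (PolynomialModule R M)).restrictScalars R ∘ₗ
    PolynomialModule.lsingle R 0

theorem toNagataModule_injective (hM : IsGVTorsionFree R M) :
    Function.Injective (toNagataModule R M) :=
  (mkLinearMap_nagata_injective hM).comp fun _ _ h =>
    Finsupp.single_injective 0 (congrArg PolynomialModule.coeff h)

theorem isGVProjective_of_subsingleton_extM_nagataModule [Module.Finite R M]
    (hM : ∀ (n : ℕ) (K : Submodule R (Fin n → R)),
      Subsingleton (extM R M (NagataModule (R := R) K) 1)) : IsGVProjective R M := by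
  classical
  obtain ⟨n, π, hπ⟩ := Module.Finite.exists_fin' R M
  let K := LinearMap.ker π
  have hK : IsGVTorsionFree R K :=
    (isGVTorsionFree_pi (Fin n)).of_injective K.subtype K.injective_subtype
  obtain ⟨h, hh⟩ := subsingleton_extM_one_iff.1 (hM n K) (Fin n → R) π hπ (toNagataModule R K)
  let loc := LocalizedModule.mkLinearMap (gvPolynomials R) (PolynomialModule R K)
  obtain ⟨f, hf⟩ := IsLocalizedModule.exist_integer_multiples_of_finset (gvPolynomials R) loc
    (Finset.univ.image fun i => h (Pi.single i 1))
  choose y hy using fun i => hf (h (Pi.single i 1)) (Finset.mem_image_of_mem _ (Finset.mem_univ i))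
  let H : (Fin n → R) →ₗ[R] PolynomialModule R K := (Pi.basisFun R (Fin n)).constr R y
  have hH : loc.restrictScalars R ∘ₗ H = (f : R[X]) • h := by
    refine (Pi.basisFun R (Fin n)).ext fun i => ?_
    rw [LinearMap.comp_apply, Module.Basis.constr_basis, LinearMap.smul_apply,
      Pi.basisFun_apply]
    exact hy i
  have hHK : ∀ k : K, H k = (f : R[X]) • PolynomialModule.single R 0 k := fun k => by
    refine mkLinearMap_nagata_injective hK ?_
    rw [map_smul]
    refine (LinearMap.congr_fun hH k).trans ?_
    rw [LinearMap.smul_apply, hh]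
    rfl
  refine ⟨_, f.2, fun j hj => contentIdeal_le_iff (I := freeFactorIdeal M).2 (fun i => ?_) hj⟩
  let c : (Fin n → R) →ₗ[R] Fin n → R := (f : R[X]).coeff i • LinearMap.id - K.subtype ∘ₗ
    Finsupp.lapply i ∘ₗ (PolynomialModule.coeffLinearEquiv R R).toLinearMap ∘ₗ H
  have hc : ∀ x, c x = (f : R[X]).coeff i • x - ((H x).coeff i : K) := fun x => rfl
  obtain ⟨g, hg⟩ := exists_comp_eq_of_ker_le π hπ c fun x hx => by
    rw [hc, hHK ⟨x, hx⟩, PolynomialModule.smul_single_apply]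
    simp
  refine ⟨n, g, π, fun m => ?_⟩
  obtain ⟨x, rfl⟩ := hπ m
  rw [hg, hc, map_sub, map_smul, LinearMap.mem_ker.1 ((H x).coeff i).2, sub_zero]

end McCoy

section Lifting

theorem IsWModule.of_wClosure_eq {N : Type} [AddCommGroup N] [Module R N] (hN : IsWModule R N)
    {A : Submodule R N} (hA : wClosure A = A) : IsWModule R A := by
  refine ⟨hN.1.of_injective A.subtype A.injective_subtype, fun J hJ =>
    subsingleton_extM_one_iff.2 ?_⟩
  intro F _ _ π _ g
  obtain ⟨h, hh⟩ := hN.exists_extension (LinearMap.ker π) (fun x => ⟨J, hJ, fun _ => smul_mem_ker π x⟩)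
    (A.subtype ∘ₗ g)
  refine ⟨h.codRestrict A fun x => hA.le ⟨J, hJ, fun j hj => ?_⟩, fun k => Subtype.ext (hh k)⟩
  rw [← map_smul, hh ⟨_, smul_mem_ker π x hj⟩]
  exact (g _).2

theorem exists_isWEnvelope {M : Type} [AddCommGroup M] [Module R M] (hM : IsGVTorsionFree R M) :
    ∃ (L : Type) (_ : AddCommGroup L) (_ : Module R L) (ι : M →ₗ[R] L), IsWEnvelope R M L ι := by
  let A := wClosure (LinearMap.range (toNagataModule R M))
  let ι : M →ₗ[R] A := (toNagataModule R M).codRestrict A fun x => le_wClosure _ ⟨x, rfl⟩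
  refine ⟨A, inferInstance, inferInstance, ι,
    isWModule_of_nagataRing.of_wClosure_eq (wClosure_wClosure _), fun a b h => ?_,
    isGVTorsion_quotient_iff.2 ?_⟩
  · exact toNagataModule_injective hM (congrArg Subtype.val h)
  · rintro ⟨x, J, hJ, hx⟩
    refine ⟨J, hJ, fun j hj => ?_⟩
    obtain ⟨m, hm⟩ := hx j hj
    exact ⟨m, Subtype.ext hm⟩

/-- Maps out of `w`-projective modules lift along surjections of modules over the `w`-Nagata
ring. -/
theorem IsWProjective.exists_lift {M : Type} [AddCommGroup M] [Module R M]
    (hM : IsWProjective R M) {E N : Type} [AddCommGroup E] [Module R E] [Module (NagataRing R) E]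
    [IsScalarTower R (NagataRing R) E] [AddCommGroup N] [Module R N] [Module (NagataRing R) N]
    [IsScalarTower R (NagataRing R) N] (q : E →ₗ[NagataRing R] N) (hq : Function.Surjective q)
    (φ : M →ₗ[R] N) : ∃ ψ : M →ₗ[R] E, ∀ x, q (ψ x) = φ x := by
  have htf : IsGVTorsionFree R (M ⧸ torGV R M) := by
    rw [isGVTorsionFree_quotient_iff, torGV_eq, wClosure_wClosure]
  obtain ⟨L, _, _, ι, hL⟩ := exists_isWEnvelope htf
  obtain ⟨φ₁, hφ₁⟩ := exists_comp_eq_of_ker_le (torGV R M).mkQ (Submodule.mkQ_surjective _) φ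
    (fun x hx => by
      rw [← LinearMap.mem_ker, Submodule.ker_mkQ, torGV_eq] at hx
      obtain ⟨J, hJ, hx⟩ := hx
      refine isGVTorsionFree_of_nagataRing (R := R) _ ⟨J, hJ, fun j hj => ?_⟩
      rw [← map_smul, (Submodule.mem_bot R).1 (hx j hj), map_zero])
  let e := LinearEquiv.ofInjective ι hL.2.1
  obtain ⟨φ₂, hφ₂⟩ := isWModule_of_nagataRing.exists_extension (LinearMap.range ι)
    (isGVTorsion_quotient_iff.1 hL.2.2) (φ₁ ∘ₗ e.symm.toLinearMap)
  have hφ₃ : ∀ m, φ₂ (ι m) = φ₁ m := fun m => by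
    rw [hφ₂ ⟨ι m, m, rfl⟩]
    exact congrArg φ₁ (e.symm_apply_apply m)
  let qR : E →ₗ[R] N := q.restrictScalars R
  let B : Submodule R (L × E) := LinearMap.ker (φ₂.coprod (-qR))
  have hB : ∀ y : L × E, y ∈ B ↔ φ₂ y.1 = q y.2 := fun y => by
    rw [LinearMap.mem_ker, LinearMap.coprod_apply, LinearMap.neg_apply, ← sub_eq_add_neg,
      sub_eq_zero]
    rfl
  let p : B →ₗ[R] L := LinearMap.fst R L E ∘ₗ B.subtype
  have hp : Function.Surjective p := fun l => by
    obtain ⟨x, hx⟩ := hq (φ₂ l)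
    exact ⟨⟨(l, x), (hB _).2 hx.symm⟩, rfl⟩
  let g : LinearMap.ker p →ₗ[R] LinearMap.ker q :=
    { toFun := fun y => ⟨y.1.1.2, by
        rw [LinearMap.mem_ker, ← (hB _).1 y.1.2]
        exact (congrArg φ₂ y.2).trans φ₂.map_zero⟩
      map_add' := fun _ _ => rfl
      map_smul' := fun _ _ => rfl }
  obtain ⟨x, hx⟩ := exists_extM_obstruction (N := LinearMap.ker q) p hp g
  obtain ⟨J, hJ, hJx⟩ := hM (LinearMap.ker q) isGVTorsionFree_of_nagataRing
    isWModule_of_nagataRing L ι hL x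
  obtain ⟨h, hh⟩ := exists_extension_of_nagataRing (N := LinearMap.ker q) (F := B)
    (K := LinearMap.ker p) g hJ fun j hj => hx j (hJx j hj)
  obtain ⟨ψ, hψ⟩ := exists_comp_eq_of_ker_le p hp
    (LinearMap.snd R L E ∘ₗ B.subtype - (LinearMap.ker q).subtype.restrictScalars R ∘ₗ h)
    (fun y hy => by
      have : h y = g ⟨y, hy⟩ := hh ⟨y, hy⟩
      rw [LinearMap.sub_apply, LinearMap.comp_apply, LinearMap.comp_apply, this]
      exact sub_self _)
  refine ⟨ψ ∘ₗ ι ∘ₗ (torGV R M).mkQ, fun m => ?_⟩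
  obtain ⟨y, hy⟩ := hp (ι ((torGV R M).mkQ m))
  rw [LinearMap.comp_apply, LinearMap.comp_apply, ← hy, hψ, ← hφ₁, ← hφ₃, ← hy]
  have h1 : q y.1.2 = φ₂ y.1.1 := ((hB _).1 y.2).symm
  have h2 : q (h y) = 0 := (h y).2
  change q (y.1.2 - h y) = φ₂ y.1.1
  rw [map_sub, h1, h2, sub_zero]

theorem exists_comp_eq_of_lift {A B N : Type} [AddCommGroup A] [Module R A] [AddCommGroup B]
    [Module R B] [AddCommGroup N] [Module R N] [Module (NagataRing R) N]
    [IsScalarTower R (NagataRing R) N] (d : A →ₗ[R] B) (c : A →ₗ[R] N)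
    (hc : ∀ a, d a = 0 → c a = 0)
    (H : ∀ (E N : Type) [AddCommGroup E] [Module R E] [Module (NagataRing R) E]
      [IsScalarTower R (NagataRing R) E] [AddCommGroup N] [Module R N] [Module (NagataRing R) N]
      [IsScalarTower R (NagataRing R) N] (q : E →ₗ[NagataRing R] N), Function.Surjective q →
      ∀ e : B →ₗ[R] N, (∀ a, e (d a) = 0) →
      ∃ e' : B →ₗ[R] E, (∀ a, e' (d a) = 0) ∧ ∀ b, q (e' b) = e b) :
    ∃ b : B →ₗ[R] N, ∀ a, b (d a) = c a := by
  obtain ⟨E, _, _, i, hi, _⟩ := exists_injective_of_nagataRing (R := R) N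
  let : Module R E := Module.compHom E (algebraMap R (NagataRing R))
  have : IsScalarTower R (NagataRing R) E := IsScalarTower.of_algebraMap_smul fun _ _ => rfl
  let iR : N →ₗ[R] E := i.restrictScalars R
  obtain ⟨c₁, hc₁⟩ := exists_comp_eq_of_ker_le d.rangeRestrict d.surjective_rangeRestrict c
    fun a ha => hc a (congrArg Subtype.val ha)
  obtain ⟨e, he⟩ := Module.Injective.exists_extension_of_flat (S := NagataRing R)
    (LinearMap.range d).subtype (LinearMap.range d).injective_subtype (iR ∘ₗ c₁)
  have hed : ∀ a, e (d a) = i (c a) := fun a => (he (d.rangeRestrict a)).trans (congrArg i (hc₁ a))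
  let q := (LinearMap.range i).mkQ
  have hqi : ∀ x, q x = 0 ↔ ∃ n, i n = x := fun x => Submodule.Quotient.mk_eq_zero _
  obtain ⟨e', he', hq⟩ := H _ _ q (Submodule.mkQ_surjective _) (q.restrictScalars R ∘ₗ e)
    fun a => (hqi _).2 ⟨c a, (hed a).symm⟩
  have hr : ∀ b, (e - e') b ∈ LinearMap.range iR := fun b => by
    refine (hqi _).1 ?_
    rw [LinearMap.sub_apply, map_sub, hq]
    exact sub_self _
  let f := LinearEquiv.ofInjective iR hi
  refine ⟨f.symm.toLinearMap ∘ₗ (e - e').codRestrict _ hr, fun a => ?_⟩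
  rw [LinearMap.comp_apply, LinearEquiv.coe_coe, LinearEquiv.symm_apply_eq]
  refine Subtype.ext ?_
  change e (d a) - e' (d a) = i (c a)
  rw [hed, he', sub_zero]

/-- A module whose maps lift along surjections of modules over the `w`-Nagata ring has no higher
extensions by modules over that ring. -/
theorem subsingleton_extM_of_exists_lift {M : Type} [AddCommGroup M] [Module R M]
    (hM : ∀ (E N : Type) [AddCommGroup E] [Module R E] [Module (NagataRing R) E]
      [IsScalarTower R (NagataRing R) E] [AddCommGroup N] [Module R N] [Module (NagataRing R) N]
      [IsScalarTower R (NagataRing R) N] (q : E →ₗ[NagataRing R] N), Function.Surjective q →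
      ∀ φ : M →ₗ[R] N, ∃ ψ : M →ₗ[R] E, ∀ x, q (ψ x) = φ x)
    (N : Type) [AddCommGroup N] [Module R N] [Module (NagataRing R) N]
    [IsScalarTower R (NagataRing R) N] (n : ℕ) : Subsingleton (extM R M N (n + 1)) := by
  let P := ProjectiveResolution.of (ModuleCat.of R M)
  suffices H : ∀ (n : ℕ) (N : Type) [AddCommGroup N] [Module R N] [Module (NagataRing R) N]
      [IsScalarTower R (NagataRing R) N] (c : P.complex.X (n + 1) →ₗ[R] N),
      (∀ y, c (P.complex.d (n + 2) (n + 1) y) = 0) →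
      ∃ b : P.complex.X n →ₗ[R] N, ∀ y, b (P.complex.d (n + 1) n y) = c y by
    obtain ⟨φ, hφ, -, hzero⟩ := exists_cocycle_map N P n
    refine subsingleton_of_forall_eq 0 fun x => ?_
    obtain ⟨⟨c, hc⟩, rfl⟩ := hφ x
    obtain ⟨b, hb⟩ := H n N c.hom fun y => ConcreteCategory.congr_hom hc y
    exact (hzero _).2 ⟨ModuleCat.ofHom b, ModuleCat.hom_ext (LinearMap.ext fun y => (hb y).symm)⟩
  have hker : ∀ (n : ℕ) (N : Type) [AddCommGroup N] [Module R N]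
      (c : P.complex.X (n + 1) →ₗ[R] N), (∀ y, c (P.complex.d (n + 2) (n + 1) y) = 0) →
      ∀ a, P.complex.d (n + 1) n a = 0 → c a = 0 := by
    intro n N _ _ c hc a ha
    obtain ⟨y, rfl⟩ := (P.d_eq_zero_iff n a).1 ha
    exact hc y
  intro n
  induction n with
  | zero =>
    intro N _ _ _ _ c hc
    refine exists_comp_eq_of_lift (P.complex.d 1 0).hom c (hker 0 N c hc) ?_
    intro E N' _ _ _ _ _ _ _ _ q hq e he
    obtain ⟨φ, hφ⟩ := exists_comp_eq_of_ker_le P.augmentation P.augmentation_surjective e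
      fun x hx => by
        obtain ⟨y, rfl⟩ := (P.augmentation_eq_zero_iff x).1 hx
        exact he y
    obtain ⟨ψ, hψ⟩ := hM E N' q hq φ
    refine ⟨ψ ∘ₗ P.augmentation, fun a => ?_, fun b => (hψ _).trans (hφ b)⟩
    rw [LinearMap.comp_apply, (P.augmentation_eq_zero_iff _).2 ⟨a, rfl⟩, map_zero]
  | succ n ih =>
    intro N _ _ _ _ c hc
    refine exists_comp_eq_of_lift (P.complex.d (n + 2) (n + 1)).hom c (hker (n + 1) N c hc) ?_
    intro E N' _ _ _ _ _ _ _ _ q hq e he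
    obtain ⟨b, hb⟩ := ih N' e he
    have := P.module_projective n
    obtain ⟨l, hl⟩ := Module.projective_lifting_property (q.restrictScalars R) b hq
    refine ⟨l ∘ₗ (P.complex.d (n + 1) n).hom, fun a => ?_, fun x => ?_⟩
    · have : P.complex.d (n + 1) n (P.complex.d (n + 2) (n + 1) a) = 0 :=
        (P.d_eq_zero_iff n _).2 ⟨a, rfl⟩
      exact (congrArg l this).trans l.map_zero
    · exact (LinearMap.congr_fun hl _).trans (hb x)

theorem memPwDaggerInfty_of_nagataRing {N : Type} [AddCommGroup N] [Module R N]
    [Module (NagataRing R) N] [IsScalarTower R (NagataRing R) N] : MemPwDaggerInfty R N := by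
  refine ⟨isGVTorsionFree_of_nagataRing, fun M _ _ hM k hk => ?_⟩
  obtain ⟨n, rfl⟩ := Nat.exists_eq_add_of_le' hk
  exact subsingleton_extM_of_exists_lift (fun _ _ => hM.exists_lift) N n

theorem IsWProjective.isWeakWProjective {M : Type} [AddCommGroup M] [Module R M]
    (hM : IsWProjective R M) : IsWeakWProjective R M :=
  fun _ _ _ hN => hN.2 M hM 1 le_rfl

theorem IsWeakWProjective.isGVProjective {M : Type} [AddCommGroup M] [Module R M]
    [Module.Finite R M] (hM : IsWeakWProjective R M) : IsGVProjective R M :=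
  isGVProjective_of_subsingleton_extM_nagataModule fun _ _ => hM _ memPwDaggerInfty_of_nagataRing

end Lifting

end NagataRing

/-- characterizations of `w`-semi-hereditary rings. -/
theorem tfae_wSemiHereditary (R : Type) [CommRing R] :
    List.TFAE
      [∀ I : Ideal R, IsFiniteType R I → IsWProjective R I,
        ∀ (F : Type) [AddCommGroup F] [Module R F], Module.Free R F →
          ∀ N : Submodule R F, IsFiniteType R N → IsWeakWProjective R N,
        ∀ I : Ideal R, IsFiniteType R I → IsWeakWProjective R I,
        ∀ (F : Type) [AddCommGroup F] [Module R F], Module.Free R F →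
          ∀ N : Submodule R F, N.FG → IsWeakWProjective R N,
        ∀ I : Ideal R, I.FG → IsWeakWProjective R I] := by
  have key (h : ∀ I : Ideal R, I.FG → IsWeakWProjective R I) (I : Ideal R) (hI : I.FG) :
      IsGVProjective R I :=
    have := Module.Finite.iff_fg.2 hI
    (h I hI).isGVProjective
  have finiteType {M : Type} [AddCommGroup M] [Module R M] {N : Submodule R M} (hN : N.FG) :
      IsFiniteType R N :=
    have := Module.Finite.iff_fg.2 hN
    isFiniteType_of_fg
  tfae_have 1 → 3 := fun h I hI => (h I hI).isWeakWProjective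
  tfae_have 3 → 5 := fun h I hI => h I (finiteType hI)
  tfae_have 5 → 1 := fun h I hI => isWProjective_of_isFiniteType (key h) I hI
  tfae_have 5 → 2 := fun h F _ _ _ N hN =>
    (isWProjective_of_isFiniteType (key h) N hN).isWeakWProjective
  tfae_have 2 → 4 := fun h F _ _ hF N hN => h F hF N (finiteType hN)
  tfae_have 4 → 5 := fun h I hI => h R inferInstance I hI
  tfae_finish
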